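/- The star K_{1,3} and the path P_4 on 4 vertices have the same Tutte polynomial, namely T(x,y) = x^3, but their cones (the graphs obtained by adding one new vertex adjacent to all four original vertices) have different numbers of spanning trees: the cone of K_{1,3} has 20 spanning trees, while the cone of P_4 has 21 spanning trees. In particular, the cones of K_{1,3} and P_4 have different Tutte polynomials. -/

import Mathlib

open SimpleGraph

open scoped Classical

/-- `c(F)`: the number of connected components of the spanning subgraph `(V, F)`. -/

noncomputable def numComponents {V : Type*} [Fintype V] (F : Finset (Sym2 V)) : ℕ :=
  Nat.card (SimpleGraph.fromEdgeSet (F : Set (Sym2 V))).ConnectedComponent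

/-- The Tutte polynomial of `G`, evaluated at `(x, y)`:
`T_G(x,y) = Σ_{F ⊆ E(G)} (x−1)^(c(F)−c(E)) * (y−1)^(c(F)+|F|−|V|)`. -/

noncomputable def tutte {V : Type*} [Fintype V] (G : SimpleGraph V) (x y : ℝ) : ℝ :=
  ∑ F ∈ G.edgeFinset.powerset,
    (x - 1) ^ (numComponents F - numComponents G.edgeFinset) *
      (y - 1) ^ (numComponents F + F.card - Fintype.card V)

/-- The star `K_{1,3}` on 4 vertices, with center `0`. -/
def starK13 : SimpleGraph (Fin 4) := SimpleGraph.fromRel fun a _ => a = 0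

/-- The cone of a graph `G`: a new vertex `none` is joined to every vertex of `G`. -/
def cone {V : Type*} (G : SimpleGraph V) : SimpleGraph (Option V) :=
  SimpleGraph.fromRel fun a b =>
    match a, b with
    | none, some _ => True
    | some u, some v => G.Adj u v
    | _, _ => False

/-- The number of spanning trees of `G`: the number of edge subsets `F ⊆ E(G)` such that
the spanning subgraph `(V, F)` is a tree. -/
noncomputable def numSpanningTrees {V : Type*} [Fintype V] (G : SimpleGraph V) : ℕ :=
  (G.edgeFinset.powerset.filter fun F =>
    (SimpleGraph.fromEdgeSet (F : Set (Sym2 V))).IsTree).card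

/-- Component labels obtained by merging along the listed edges. -/
def compLabel {V : Type*} [DecidableEq V] : List (V × V) → V → V
  | [], v => v
  | e :: l, v => if compLabel l v = compLabel l e.1 then compLabel l e.2 else compLabel l v

/-- The edge set attached to a list of pairs. -/
noncomputable def edgesOf {V : Type*} (l : List (V × V)) : Finset (Sym2 V) :=
  (l.map fun e => s(e.1, e.2)).toFinset

/-- Computable number of components. -/
def compCount {V : Type*} [Fintype V] [DecidableEq V] (l : List (V × V)) : ℕ :=
  (Finset.univ.image (compLabel l)).card

/-- All sublists. -/
def subLists {α : Type*} : List α → List (List α)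
  | [] => [[]]
  | a :: l => subLists l ++ (subLists l).map (List.cons a)

lemma mem_edgesOf {V : Type*} (l : List (V × V)) (u v : V) :
    s(u, v) ∈ edgesOf l ↔ (u, v) ∈ l ∨ (v, u) ∈ l := by
  simp only [edgesOf, List.mem_toFinset, List.mem_map, Prod.exists, Sym2.eq_iff]
  constructor
  · rintro ⟨a, b, h, ⟨rfl, rfl⟩ | ⟨rfl, rfl⟩⟩ <;> simp [h]
  · rintro (h | h)
    · exact ⟨_, _, h, Or.inl ⟨rfl, rfl⟩⟩
    · exact ⟨_, _, h, Or.inr ⟨rfl, rfl⟩⟩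

lemma edgesOf_cons {V : Type*} (e : V × V) (l : List (V × V)) :
    edgesOf (e :: l) = insert s(e.1, e.2) (edgesOf l) := by
  ext x
  simp [edgesOf]

lemma compLabel_eq_of_mem {V : Type*} [DecidableEq V] (l : List (V × V)) (u v : V)
    (h : (u, v) ∈ l) : compLabel l u = compLabel l v := by
  induction l with
  | nil => simp at h
  | cons e l ih =>
    rcases List.mem_cons.1 h with h | h
    · subst h
      simp only [compLabel]
      split_ifs <;> simp_all
    · simp only [compLabel, ih h]

lemma reachable_of_compLabel {V : Type*} [DecidableEq V] (l : List (V × V)) (u v : V)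
    (h : compLabel l u = compLabel l v) :
    (SimpleGraph.fromEdgeSet (edgesOf l : Set (Sym2 V))).Reachable u v := by
  induction l generalizing u v with
  | nil => simp only [compLabel] at h; subst h; rfl
  | cons e l ih =>
    have mono : ∀ a b, compLabel l a = compLabel l b →
        (SimpleGraph.fromEdgeSet (edgesOf (e :: l) : Set (Sym2 V))).Reachable a b := by
      intro a b hab
      refine (ih a b hab).mono ?_
      apply SimpleGraph.fromEdgeSet_mono
      rw [edgesOf_cons]
      exact Finset.coe_subset.2 (by intro x hx; simp [hx])
    have he : (SimpleGraph.fromEdgeSet (edgesOf (e :: l) : Set (Sym2 V))).Reachable e.1 e.2 := by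
      by_cases h12 : e.1 = e.2
      · rw [h12]
      · apply SimpleGraph.Adj.reachable
        rw [SimpleGraph.fromEdgeSet_adj]
        refine ⟨?_, h12⟩
        rw [edgesOf_cons]
        simp
    simp only [compLabel] at h
    split_ifs at h with h1 h2 h2
    · exact mono _ _ (h1.trans h2.symm)
    · exact ((mono _ _ h1).trans he).trans (mono _ _ h)
    · exact (mono _ _ h).trans (he.symm.trans (mono _ _ h2.symm))
    · exact mono _ _ h

lemma reachable_iff_compLabel {V : Type*} [DecidableEq V] (l : List (V × V)) (u v : V) :
    (SimpleGraph.fromEdgeSet (edgesOf l : Set (Sym2 V))).Reachable u v ↔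
      compLabel l u = compLabel l v := by
  refine ⟨?_, reachable_of_compLabel l u v⟩
  rintro ⟨p⟩
  induction p with
  | nil => rfl
  | cons h _ ih =>
    rw [← ih]
    rw [SimpleGraph.fromEdgeSet_adj] at h
    rcases (mem_edgesOf _ _ _).1 (Finset.mem_coe.1 h.1) with h | h
    · exact compLabel_eq_of_mem _ _ _ h
    · exact (compLabel_eq_of_mem _ _ _ h).symm

lemma numComponents_edgesOf {V : Type*} [Fintype V] [DecidableEq V] (l : List (V × V)) :
    numComponents (edgesOf l) = compCount l := by
  have e : (SimpleGraph.fromEdgeSet (edgesOf l : Set (Sym2 V))).ConnectedComponent ≃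
      Set.range (compLabel l) := by
    refine Equiv.ofBijective (fun c => c.lift (fun v => ⟨compLabel l v, v, rfl⟩) ?_) ⟨?_, ?_⟩
    · intro v w p _
      exact Subtype.ext ((reachable_iff_compLabel l v w).1 ⟨p⟩)
    · intro a b
      refine SimpleGraph.ConnectedComponent.ind₂ ?_ a b
      intro v w h
      exact SimpleGraph.ConnectedComponent.sound
        ((reachable_iff_compLabel l v w).2 (congrArg Subtype.val h))
    · rintro ⟨_, v, rfl⟩
      exact ⟨SimpleGraph.connectedComponentMk _ v, rfl⟩
  rw [numComponents, Nat.card_congr e, compCount, Nat.card_coe_set_eq, ← Set.ncard_coe_finset]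
  simp

lemma sum_powerset_edgesOf {V M : Type*} [AddCommMonoid M] (l : List (V × V))
    (hl : (l.map fun e => s(e.1, e.2)).Nodup) (f : Finset (Sym2 V) → M) :
    ∑ F ∈ (edgesOf l).powerset, f F = ((subLists l).map fun s => f (edgesOf s)).sum := by
  induction l generalizing f with
  | nil => simp [edgesOf, subLists]
  | cons e l ih =>
    rw [List.map_cons, List.nodup_cons] at hl
    have hn : s(e.1, e.2) ∉ edgesOf l := by simpa [edgesOf] using hl.1
    rw [edgesOf_cons, Finset.sum_powerset_insert hn, ih hl.2, ih hl.2]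
    simp [subLists, Function.comp_def, edgesOf_cons]

lemma subLists_sublist {α : Type*} (l s : List α) (h : s ∈ subLists l) : s.Sublist l := by
  induction l generalizing s with
  | nil => simp_all [subLists]
  | cons a l ih =>
    simp only [subLists, List.mem_append, List.mem_map] at h
    rcases h with h | ⟨t, h, rfl⟩
    · exact (ih _ h).cons a
    · exact (ih _ h).cons_cons a

lemma card_edgesOf {V : Type*} (l s : List (V × V))
    (hl : (l.map fun e => s(e.1, e.2)).Nodup) (h : s ∈ subLists l) :
    (edgesOf s).card = s.length := by
  rw [edgesOf, List.toFinset_card_of_nodup, List.length_map]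
  exact hl.sublist ((subLists_sublist l s h).map _)

/-- The list of exponents in the Tutte polynomial. -/
def tutteExps {V : Type*} [Fintype V] [DecidableEq V] (l : List (V × V)) : List (ℕ × ℕ) :=
  (subLists l).map fun s => (compCount s - compCount l, compCount s + s.length - Fintype.card V)

/-- Computable number of spanning trees. -/
def treeCount {V : Type*} [Fintype V] [DecidableEq V] (l : List (V × V)) : ℕ :=
  ((subLists l).map fun s =>
    if compCount s = 1 ∧ s.length + 1 = Fintype.card V then 1 else 0).sum

lemma tutte_eq {V : Type*} [Fintype V] [DecidableEq V] (G : SimpleGraph V) (l : List (V × V))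
    (hl : (l.map fun e => s(e.1, e.2)).Nodup) (hG : G.edgeFinset = edgesOf l) (x y : ℝ) :
    tutte G x y = ((tutteExps l).map fun p => (x - 1) ^ p.1 * (y - 1) ^ p.2).sum := by
  rw [_root_.tutte, hG, sum_powerset_edgesOf l hl, tutteExps, List.map_map]
  congr 1
  apply List.map_congr_left
  intro s hs
  simp only [Function.comp, numComponents_edgesOf, card_edgesOf l s hl hs]

lemma numSpanningTrees_eq_card {V : Type*} [Fintype V] (G : SimpleGraph V) :
    numSpanningTrees G = (G.edgeFinset.powerset.filter fun F : Finset (Sym2 V) =>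
      (SimpleGraph.fromEdgeSet (F : Set (Sym2 V))).IsTree).card := by
  rw [numSpanningTrees]
  symm
  apply Finset.card_bij (fun (F : Finset (Sym2 V)) _ => (F : Set (Sym2 V)))
  · intro F hF
    rw [Finset.mem_filter] at hF ⊢
    refine ⟨?_, hF.2⟩
    simp only [Finset.bind_def, Finset.pure_def, Finset.mem_sup, Finset.mem_singleton]
    exact ⟨F, hF.1, rfl⟩
  · intro F _ F' _ h
    exact Finset.coe_injective h
  · intro S hS
    rw [Finset.mem_filter] at hS
    obtain ⟨h1, h2⟩ := hS
    simp only [Finset.bind_def, Finset.pure_def, Finset.mem_sup, Finset.mem_singleton] at h1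
    obtain ⟨F, hF, rfl⟩ := h1
    exact ⟨F, Finset.mem_filter.2 ⟨hF, h2⟩, rfl⟩

lemma numSpanningTrees_eq {V : Type*} [Fintype V] [DecidableEq V] [Nonempty V]
    (G : SimpleGraph V) (l : List (V × V))
    (hl : (l.map fun e => s(e.1, e.2)).Nodup) (hG : G.edgeFinset = edgesOf l) :
    numSpanningTrees G = treeCount l := by
  rw [numSpanningTrees_eq_card, Finset.card_filter, hG, sum_powerset_edgesOf l hl, treeCount]
  congr 1
  apply List.map_congr_left
  intro s hs
  congr 1
  rw [SimpleGraph.isTree_iff_connected_and_card, ← numComponents_edgesOf,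
    ← card_edgesOf l s hl hs, eq_iff_iff]
  have h1 : (SimpleGraph.fromEdgeSet (edgesOf s : Set (Sym2 V))).edgeSet = edgesOf s := by
    rw [SimpleGraph.edgeSet_fromEdgeSet, sdiff_eq_left, Set.disjoint_left]
    intro e he
    have : e ∈ G.edgeFinset := by
      rw [hG]
      have := ((subLists_sublist l s hs).map fun e => s(e.1, e.2)).subset
      simp only [edgesOf, Finset.mem_coe, List.mem_toFinset] at he ⊢
      exact this he
    have := G.not_isDiag_of_mem_edgeFinset this
    simpa using this
  rw [h1]
  have h2 : (SimpleGraph.fromEdgeSet (edgesOf s : Set (Sym2 V))).Connected ↔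
      numComponents (edgesOf s) = 1 := by
    rw [numComponents, Nat.card_eq_one_iff_unique, SimpleGraph.connected_iff]
    constructor
    · rintro ⟨h, _⟩
      exact ⟨h.subsingleton_connectedComponent, inferInstance⟩
    · rintro ⟨h, _⟩
      exact ⟨fun u v => SimpleGraph.ConnectedComponent.exact (h.elim _ _), inferInstance⟩
  rw [h2]
  simp

lemma edgeFinset_eq {V : Type*} [Fintype V] (G : SimpleGraph V) (l : List (V × V))
    (h : ∀ u v, G.Adj u v ↔ (u, v) ∈ l ∨ (v, u) ∈ l) : G.edgeFinset = edgesOf l := by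
  ext e
  induction e with
  | _ u v => rw [mem_edgesOf, ← h, SimpleGraph.mem_edgeFinset, SimpleGraph.mem_edgeSet]

/-- Edges of the star. -/
def starEdges : List (Fin 4 × Fin 4) := [(0, 1), (0, 2), (0, 3)]

/-- Edges of the path. -/
def pathEdges : List (Fin 4 × Fin 4) := [(0, 1), (1, 2), (2, 3)]

/-- Edges of the cone. -/
def coneEdges (l : List (Fin 4 × Fin 4)) : List (Option (Fin 4) × Option (Fin 4)) :=
  [(none, some 0), (none, some 1), (none, some 2), (none, some 3)] ++
    l.map fun e => (some e.1, some e.2)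

lemma star_adj (u v : Fin 4) : starK13.Adj u v ↔ (u, v) ∈ starEdges ∨ (v, u) ∈ starEdges := by
  rw [starK13, SimpleGraph.fromRel_adj]
  revert u v
  decide

lemma path_adj (u v : Fin 4) :
    (SimpleGraph.pathGraph 4).Adj u v ↔ (u, v) ∈ pathEdges ∨ (v, u) ∈ pathEdges := by
  rw [SimpleGraph.pathGraph_adj]
  revert u v
  decide

lemma cone_adj (G : SimpleGraph (Fin 4)) (l : List (Fin 4 × Fin 4))
    (h : ∀ u v, G.Adj u v ↔ (u, v) ∈ l ∨ (v, u) ∈ l) (u v : Option (Fin 4)) :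
    (cone G).Adj u v ↔ (u, v) ∈ coneEdges l ∨ (v, u) ∈ coneEdges l := by
  rw [cone, SimpleGraph.fromRel_adj]
  rcases u with _ | u <;> rcases v with _ | v
  · simp [coneEdges]
  · simp [coneEdges]; fin_cases v <;> simp
  · simp [coneEdges]; fin_cases u <;> simp
  · have : G.Adj u v → u ≠ v := fun h => h.ne
    have h' := G.adj_comm u v
    simp [coneEdges, ← h]
    tauto

/-- `K_{1,3}` and `P_4` both have Tutte polynomial `x^3`, but their cones have different
numbers of spanning trees (20 and 21 respectively); in particular the cones have
different Tutte polynomials. -/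
theorem stmt_12 :
    (∀ x y : ℝ, tutte starK13 x y = x ^ 3 ∧ tutte (SimpleGraph.pathGraph 4) x y = x ^ 3) ∧
      numSpanningTrees (cone starK13) = 20 ∧
      numSpanningTrees (cone (SimpleGraph.pathGraph 4)) = 21 ∧
      ∃ x y : ℝ, tutte (cone starK13) x y ≠ tutte (cone (SimpleGraph.pathGraph 4)) x y := by
  have hs := edgeFinset_eq _ _ star_adj
  have hp := edgeFinset_eq _ _ path_adj
  have hcs := edgeFinset_eq _ _ (cone_adj _ _ star_adj)
  have hcp := edgeFinset_eq _ _ (cone_adj _ _ path_adj)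
  have ns : (starEdges.map fun e => s(e.1, e.2)).Nodup := by decide +kernel
  have np : (pathEdges.map fun e => s(e.1, e.2)).Nodup := by decide +kernel
  have ncs : ((coneEdges starEdges).map fun e => s(e.1, e.2)).Nodup := by decide +kernel
  have ncp : ((coneEdges pathEdges).map fun e => s(e.1, e.2)).Nodup := by decide +kernel
  refine ⟨fun x y => ⟨?_, ?_⟩, ?_, ?_, 1, 1, ?_⟩
  · rw [tutte_eq _ _ ns hs]
    have : tutteExps starEdges =
      [(3, 0), (2, 0), (2, 0), (1, 0), (2, 0), (1, 0), (1, 0), (0, 0)] := by decide +kernel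
    rw [this]
    simp
    ring
  · rw [tutte_eq _ _ np hp]
    have : tutteExps pathEdges =
      [(3, 0), (2, 0), (2, 0), (1, 0), (2, 0), (1, 0), (1, 0), (0, 0)] := by decide +kernel
    rw [this]
    simp
    ring
  · rw [numSpanningTrees_eq _ _ ncs hcs]
    decide +kernel
  · rw [numSpanningTrees_eq _ _ ncp hcp]
    decide +kernel
  · rw [tutte_eq _ _ ncs hcs, tutte_eq _ _ ncp hcp]
    have key : ∀ L : List (ℕ × ℕ),
        (L.map fun p => ((1 : ℝ) - 1) ^ p.1 * ((1 : ℝ) - 1) ^ p.2).sum =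
          ((L.map fun p => 0 ^ p.1 * 0 ^ p.2).sum : ℕ) := by
      intro L
      induction L with
      | nil => simp
      | cons a L ih => simp [ih] at ih ⊢; exact ih
    rw [key, key, Ne, Nat.cast_inj]
    decide +kernel
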